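/- Let L_n denote the set of FAS structures with universe {1,…,n}, and let A_n ⊆ L_n denote the set of those structures that are symmetric, integral, and satisfy the associativity condition. Then |A_n|/|L_n| tends to 1 as n → ∞. (Equivalently: almost all finite nonassociative relation algebras are symmetric integral relation algebras.) -/

import Mathlib

open Filter Topology

/-- Labelled FAS-type data on the universe `Fin n`: a unary function `f`,
a set `I` of identity atoms, and a ternary relation `T`. -/
abbrev FASData (n : ℕ) :=
  (Fin n → Fin n) × Finset (Fin n) × Finset (Fin n × Fin n × Fin n)

/-- The conditions (P) and (I) defining FAS structures. -/
def IsFAS {n : ℕ} (M : FASData n) : Prop :=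
  (∀ a b c : Fin n, (a, b, c) ∈ M.2.2 → (M.1 a, c, b) ∈ M.2.2 ∧ (c, M.1 b, a) ∈ M.2.2) ∧
  (∀ a b : Fin n, a = b ↔ ∃ i ∈ M.2.1, (a, i, b) ∈ M.2.2)

/-- A structure is symmetric iff `f` is the identity. -/
def FASSymmetric {n : ℕ} (M : FASData n) : Prop := ∀ x, M.1 x = x

/-- A structure is integral iff `|I| = 1`. -/
def FASIntegral {n : ℕ} (M : FASData n) : Prop := M.2.1.card = 1

/-- The associativity condition on an atom structure: it holds exactly when the
associated complex algebra is associative, i.e., is a relation algebra. -/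
def FASAssociative {n : ℕ} (M : FASData n) : Prop :=
  ∀ a b c d : Fin n,
    (∃ x, (a, b, x) ∈ M.2.2 ∧ (x, c, d) ∈ M.2.2) ↔
    (∃ y, (b, c, y) ∈ M.2.2 ∧ (a, y, d) ∈ M.2.2)

namespace FASCount

section Orbits

variable {V : Type*}

/-- The action of `S₃` on triples in which odd permutations also apply the involution `f`
to every coordinate. -/
abbrev twistedAction (f : V → V) (hf : Function.Involutive f) :
    MulAction (Equiv.Perm (Fin 3)) (Fin 3 → V) where
  smul σ t := fun i => if Equiv.Perm.sign σ = 1 then t (σ⁻¹ i) else f (t (σ⁻¹ i))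
  one_smul t := by
    funext i
    change (if Equiv.Perm.sign 1 = 1 then t _ else _) = _
    simp
  mul_smul σ τ t := by
    funext i
    change (if Equiv.Perm.sign (σ * τ) = 1 then t _ else f (t _)) =
      if Equiv.Perm.sign σ = 1 then (if Equiv.Perm.sign τ = 1 then t _ else f (t _))
      else f (if Equiv.Perm.sign τ = 1 then t _ else f (t _))
    have h : ((-1 : ℤˣ) = 1) = False := by simp
    rcases Int.units_eq_one_or (Equiv.Perm.sign σ) with hσ | hσ <;>
    rcases Int.units_eq_one_or (Equiv.Perm.sign τ) with hτ | hτ <;>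
    simp [hσ, hτ, h, hf _]

lemma twistedAction_apply (f : V → V) (hf : Function.Involutive f) (σ : Equiv.Perm (Fin 3))
    (t : Fin 3 → V) (i : Fin 3) :
    letI := twistedAction f hf
    (σ • t) i = if Equiv.Perm.sign σ = 1 then t (σ⁻¹ i) else f (t (σ⁻¹ i)) := rfl

lemma univ_perm_fin_three : (Finset.univ : Finset (Equiv.Perm (Fin 3))) =
    {1, finRotate 3, (finRotate 3)⁻¹, Equiv.swap 0 1, Equiv.swap 0 2, Equiv.swap 1 2} := by
  decide

/-- The orbits of the twisted action, as a type. -/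
abbrev TwistedOrbits (f : V → V) (hf : Function.Involutive f) : Type _ :=
  Quotient (@MulAction.orbitRel _ _ _ (twistedAction f hf))

variable [Fintype V]

lemma six_mul_card_twistedOrbits_le (f : V → V) (hf : Function.Involutive f) :
    6 * Nat.card (TwistedOrbits f hf) ≤
      Nat.card V ^ 3 + 3 * (Nat.card V * Nat.card {x // f x = x}) + 2 * Nat.card V := by
  classical
  let := twistedAction f hf
  have key := MulAction.sum_card_fixedBy_eq_card_orbits_mul_card_group
    (Equiv.Perm (Fin 3)) (Fin 3 → V)
  have hcard : Fintype.card (Equiv.Perm (Fin 3)) = 6 := by decide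
  have h1 : Fintype.card (MulAction.fixedBy (Fin 3 → V) (1 : Equiv.Perm (Fin 3))) ≤
      Fintype.card V ^ 3 := by
    refine (Fintype.card_subtype_le _).trans ?_
    simp
  have hrot : ∀ σ ∈ ({finRotate 3, (finRotate 3)⁻¹} : Finset (Equiv.Perm (Fin 3))),
      Fintype.card (MulAction.fixedBy (Fin 3 → V) σ) ≤ Fintype.card V := by
    intro σ hσ
    refine Fintype.card_le_of_injective (fun t => t.1 0) ?_
    have hs : ∀ σ ∈ ({finRotate 3, (finRotate 3)⁻¹} : Finset (Equiv.Perm (Fin 3))),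
      Equiv.Perm.sign σ = 1 ∧ (σ⁻¹ 1 = 0 ∧ σ⁻¹ 2 = 1 ∨ σ⁻¹ 2 = 0 ∧ σ⁻¹ 1 = 2) := by decide
    obtain ⟨hs1, hs2⟩ := hs σ hσ
    have hfix : ∀ t : MulAction.fixedBy (Fin 3 → V) σ, ∀ i, t.1 (σ⁻¹ i) = t.1 i := by
      intro t i
      have := congrFun t.2 i
      rwa [twistedAction_apply, if_pos hs1] at this
    intro t u htu
    apply Subtype.ext
    have a1 := hfix t 1
    have a2 := hfix t 2
    have b1 := hfix u 1
    have b2 := hfix u 2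
    funext i
    change t.1 0 = u.1 0 at htu
    rcases hs2 with ⟨e1, e2⟩ | ⟨e1, e2⟩ <;> simp only [e1, e2] at a1 a2 b1 b2 <;>
      fin_cases i <;> grind
  have hswap : ∀ σ ∈ ({Equiv.swap 0 1, Equiv.swap 0 2, Equiv.swap 1 2} :
      Finset (Equiv.Perm (Fin 3))),
      Fintype.card (MulAction.fixedBy (Fin 3 → V) σ) ≤
        Fintype.card V * Fintype.card {x // f x = x} := by
    intro σ hσ
    have hs : ∀ σ ∈ ({Equiv.swap 0 1, Equiv.swap 0 2, Equiv.swap 1 2} :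
      Finset (Equiv.Perm (Fin 3))), Equiv.Perm.sign σ ≠ 1 ∧
        ∃ i j k, σ⁻¹ i = i ∧ σ⁻¹ j = k ∧ ∀ l, l = i ∨ l = j ∨ l = k := by decide
    obtain ⟨hs1, i, j, k, hi, hj, hl⟩ := hs σ hσ
    have hfix : ∀ t : MulAction.fixedBy (Fin 3 → V) σ, ∀ i, f (t.1 (σ⁻¹ i)) = t.1 i := by
      intro t i
      have := congrFun t.2 i
      rwa [twistedAction_apply, if_neg hs1] at this
    rw [← Fintype.card_prod]
    refine Fintype.card_le_of_injective
      (fun t => (t.1 k, ⟨t.1 i, by simpa [hi] using hfix t i⟩)) ?_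
    intro t u htu
    simp only [Prod.mk.injEq, Subtype.mk.injEq] at htu
    have a1 := hfix t j
    have b1 := hfix u j
    rw [hj] at a1 b1
    apply Subtype.ext
    funext l
    rcases hl l with rfl | rfl | rfl
    · exact htu.2
    · rw [← a1, ← b1, htu.1]
    · exact htu.1
  simp only [Finset.mem_insert, Finset.mem_singleton, forall_eq_or_imp, forall_eq] at hrot hswap
  have hsum : ∀ g : Equiv.Perm (Fin 3) → ℕ, ∑ σ, g σ = g 1 + (g (finRotate 3) +
      (g (finRotate 3)⁻¹ + (g (Equiv.swap 0 1) + (g (Equiv.swap 0 2) + g (Equiv.swap 1 2))))) := by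
    intro g
    rw [univ_perm_fin_three, Finset.sum_insert (by decide), Finset.sum_insert (by decide),
      Finset.sum_insert (by decide), Finset.sum_insert (by decide), Finset.sum_insert (by decide),
      Finset.sum_singleton]
  rw [hsum, hcard] at key
  simp only [Nat.card_eq_fintype_card]
  rw [mul_comm 6]
  refine key.symm.le.trans ?_
  omega

end Orbits

section Structure

variable {n : ℕ} {f : Fin n → Fin n} {I : Finset (Fin n)} {T : Finset (Fin n × Fin n × Fin n)}

lemma involutive_of_isFAS (h : IsFAS (f, I, T)) : Function.Involutive f := by
  intro a
  obtain ⟨i, hi, ht⟩ := (h.2 a a).1 rfl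
  exact (h.2 _ _).2 ⟨i, hi, (h.1 _ _ _ (h.1 _ _ _ ht).1).1⟩

lemma fixed_of_isFAS (h : IsFAS (f, I, T)) {i : Fin n} (hi : i ∈ I) : f i = i := by
  obtain ⟨j, hj, ht⟩ := (h.2 i i).1 rfl
  have hij : f i = j := (h.2 _ _).2 ⟨i, hi, (h.1 _ _ _ ht).1⟩
  have h2 : (i, f j, i) ∈ T := (h.1 _ _ _ ht).2
  rw [← hij, involutive_of_isFAS h i] at h2
  exact (h.2 _ _).2 ⟨i, hi, (h.1 _ _ _ h2).1⟩

lemma reflect_left_iff (h : IsFAS (f, I, T)) (a b c : Fin n) :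
    (f a, c, b) ∈ T ↔ (a, b, c) ∈ T :=
  ⟨fun ht => by simpa [involutive_of_isFAS h a] using (h.1 _ _ _ ht).1, fun ht => (h.1 _ _ _ ht).1⟩

lemma reflect_right_iff (h : IsFAS (f, I, T)) (a b c : Fin n) :
    (c, f b, a) ∈ T ↔ (a, b, c) ∈ T :=
  ⟨fun ht => by simpa [involutive_of_isFAS h b] using (h.1 _ _ _ ht).2, fun ht => (h.1 _ _ _ ht).2⟩

/-- The involution restricted to the non-identity atoms. -/
def restrict (f : Fin n → Fin n) (I : Finset (Fin n)) (hf : Function.Involutive f)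
    (hI : ∀ i ∈ I, f i = i) (x : {x // x ∉ I}) : {x // x ∉ I} :=
  ⟨f x, fun hx => x.2 (by have := hI _ hx; rw [hf] at this; rwa [this])⟩

lemma restrict_involutive (hf : Function.Involutive f) (hI : ∀ i ∈ I, f i = i) :
    Function.Involutive (restrict f I hf hI) :=
  fun x => Subtype.ext (hf x)

lemma twisted_smul_mem_iff (h : IsFAS (f, I, T)) (hf : Function.Involutive f)
    (hI : ∀ i ∈ I, f i = i) (σ : Equiv.Perm (Fin 3)) (t : Fin 3 → {x // x ∉ I}) :
    letI := twistedAction _ (restrict_involutive hf hI)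
    (((σ • t) 0 : Fin n), ((σ • t) 1 : Fin n), f ((σ • t) 2 : Fin n)) ∈ T ↔
      ((t 0 : Fin n), (t 1 : Fin n), f (t 2 : Fin n)) ∈ T := by
  have hσ : σ ∈ (Finset.univ : Finset (Equiv.Perm (Fin 3))) := Finset.mem_univ σ
  have L := reflect_left_iff h
  have R := reflect_right_iff h
  rw [univ_perm_fin_three] at hσ
  simp only [twistedAction_apply]
  have s1 : Equiv.Perm.sign (finRotate 3) = 1 := by decide
  have s3 : (finRotate 3) 0 = 1 ∧ (finRotate 3) 1 = 2 ∧ (finRotate 3) 2 = 0 := by decide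
  have s4 : (finRotate 3)⁻¹ 0 = 2 ∧ (finRotate 3)⁻¹ 1 = 0 ∧ (finRotate 3)⁻¹ 2 = 1 := by decide
  have s5 : ((-1 : ℤˣ) = 1) = False := by simp
  have q1 : (Equiv.swap 0 1 : Equiv.Perm (Fin 3)) 2 = 2 := by decide
  have q2 : (Equiv.swap 0 2 : Equiv.Perm (Fin 3)) 1 = 1 := by decide
  have q3 : (Equiv.swap 1 2 : Equiv.Perm (Fin 3)) 0 = 0 := by decide
  simp only [Finset.mem_insert, Finset.mem_singleton] at hσ
  have rot : ∀ a b c, (c, a, f b) ∈ T ↔ (a, b, f c) ∈ T := by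
    intro a b c
    rw [← R a b (f c), ← L (f c), hf c]
  rcases hσ with rfl | rfl | rfl | rfl | rfl | rfl
  · simp
  · simp only [s1, s4, if_true]
    exact rot _ _ _
  · simp only [Equiv.Perm.sign_inv, s1, inv_inv, s3, if_true]
    exact (rot _ _ _).symm
  · simp [Equiv.swap_inv, s5, q1, restrict, hf _]
    rw [L (t 1), ← L (t 0), ← R (f (t 0)), hf]
  · simp [Equiv.swap_inv, s5, q2, restrict, hf _]
    rw [R]
  · simp [Equiv.swap_inv, s5, q3, restrict, hf _]
    rw [L]

/-- The number of ternary relations completing `f` and `I` to an FAS structure. -/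
noncomputable def relCount (f : Fin n → Fin n) (I : Finset (Fin n)) : ℕ :=
  Nat.card {T : Finset (Fin n × Fin n × Fin n) // IsFAS (f, I, T)}

/-- A relation `T` is determined by the orbits of non-identity triples it contains, and by the
nonempty set of identity atoms `i` with `(a, i, a) ∈ T`, for each atom `a`. -/
lemma relCount_le (hf : Function.Involutive f) (hI : ∀ i ∈ I, f i = i) :
    relCount f I ≤
      2 ^ Nat.card (TwistedOrbits _ (restrict_involutive hf hI)) * (2 ^ I.card - 1) ^ n := by
  classical
  let := twistedAction _ (restrict_involutive hf hI)
  let P (T : Finset (Fin n × Fin n × Fin n)) (t : Fin 3 → {x // x ∉ I}) : Prop :=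
    ((t 0 : Fin n), (t 1 : Fin n), f (t 2 : Fin n)) ∈ T
  let orbitSet (T : Finset (Fin n × Fin n × Fin n)) :
      Set (TwistedOrbits _ (restrict_involutive hf hI)) := {ω | ∃ t, ⟦t⟧ = ω ∧ P T t}
  have mem_orbitSet : ∀ T, IsFAS (f, I, T) → ∀ t, ⟦t⟧ ∈ orbitSet T ↔ P T t := by
    intro T hT t
    constructor
    · rintro ⟨u, hu, hP⟩
      obtain ⟨σ, hσ⟩ := Quotient.exact hu
      have := twisted_smul_mem_iff hT hf hI σ t
      change σ • t = u at hσ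
      rw [hσ] at this
      exact this.1 hP
    · exact fun h => ⟨t, rfl, h⟩
  let J := {s : Finset (Fin n) // s ∈ I.powerset.erase ∅}
  let idSet (T : {T : Finset (Fin n × Fin n × Fin n) // IsFAS (f, I, T)}) (a : Fin n) : J :=
    ⟨I.filter fun i => (a, i, a) ∈ T.1, by
      obtain ⟨i, hi, ht⟩ := (T.2.2 a a).1 rfl
      rw [Finset.mem_erase, Finset.mem_powerset]
      exact ⟨Finset.ne_empty_of_mem (Finset.mem_filter.2 ⟨hi, ht⟩), Finset.filter_subset _ _⟩⟩
  have hcard : Nat.card (Set (TwistedOrbits _ (restrict_involutive hf hI)) × (Fin n → J)) =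
      2 ^ Nat.card (TwistedOrbits _ (restrict_involutive hf hI)) * (2 ^ I.card - 1) ^ n := by
    have hJ : Nat.card J = 2 ^ I.card - 1 := by
      simp only [J]
      rw [Nat.card_eq_fintype_card, Fintype.card_coe,
        Finset.card_erase_of_mem (Finset.empty_mem_powerset I), Finset.card_powerset]
    rw [Nat.card_prod, Nat.card_fun, hJ, Nat.card_fin]
    simp [Nat.card_eq_fintype_card]
  rw [← hcard]
  refine Nat.card_le_card_of_injective (fun T => (orbitSet T.1, idSet T)) ?_
  rintro ⟨T, hT⟩ ⟨T', hT'⟩ h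
  simp only [Prod.mk.injEq] at h
  obtain ⟨h1, h2⟩ := h
  have mid : ∀ a b c, b ∈ I → ((a, b, c) ∈ T ↔ (a, b, c) ∈ T') := by
    intro a b c hb
    by_cases hac : a = c
    · subst hac
      have := congrArg Subtype.val (congrFun h2 a)
      have := Finset.ext_iff.1 this b
      simpa [idSet, hb] using this
    · exact ⟨fun h => absurd ((hT.2 _ _).2 ⟨b, hb, h⟩) hac,
        fun h => absurd ((hT'.2 _ _).2 ⟨b, hb, h⟩) hac⟩
  apply Subtype.ext
  ext ⟨a, b, c⟩
  change (a, b, c) ∈ T ↔ (a, b, c) ∈ T'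
  by_cases hb : b ∈ I
  · exact mid a b c hb
  by_cases hc : c ∈ I
  · rw [← reflect_left_iff hT, ← reflect_left_iff hT']
    exact mid _ _ _ hc
  by_cases ha : a ∈ I
  · rw [← reflect_right_iff hT, ← reflect_right_iff hT', ← reflect_left_iff hT,
      ← reflect_left_iff hT']
    exact mid _ _ _ ha
  have := mem_orbitSet T hT ![⟨a, ha⟩, ⟨b, hb⟩, restrict f I hf hI ⟨c, hc⟩]
  have := mem_orbitSet T' hT' ![⟨a, ha⟩, ⟨b, hb⟩, restrict f I hf hI ⟨c, hc⟩]
  simp_all [P, restrict, hf c]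

lemma card_fixed_add_card_moved_le (hf : Function.Involutive f) (hI : ∀ i ∈ I, f i = i) :
    Nat.card {x // restrict f I hf hI x = x} + (Finset.univ.filter fun x => f x ≠ x).card ≤
      Nat.card {x // x ∉ I} := by
  classical
  rw [Nat.card_congr (Equiv.sumCompl fun x => restrict f I hf hI x = x).symm, Nat.card_sum]
  gcongr
  rw [← Fintype.card_subtype, ← Nat.card_eq_fintype_card]
  refine Nat.card_le_card_of_injective
    (fun x => ⟨⟨x.1, fun hx => x.2 (hI _ hx)⟩, fun hx => x.2 (congrArg Subtype.val hx)⟩) ?_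
  intro x y hxy
  simpa [Subtype.ext_iff] using hxy

lemma card_add_card_notMem (I : Finset (Fin n)) : Nat.card {x // x ∉ I} + I.card = n := by
  rw [Nat.card_eq_fintype_card, Fintype.card_subtype_compl]
  simp only [Fintype.card_fin, Fintype.card_coe]
  have := card_finset_fin_le I
  omega

lemma six_mul_choose_three (k : ℕ) : 6 * (k + 2).choose 3 = (k + 2) * (k + 1) * k := by
  have := Nat.descFactorial_eq_factorial_mul_choose (k + 2) 3
  simp [Nat.descFactorial, Nat.factorial] at this
  linarith

lemma two_pow_le_of_sixth_root {θ : ℝ} (h0 : 0 < θ) (h1 : θ ≤ 1) (h6 : θ ^ 6 = 1 / 2)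
    {a b c : ℕ} (h : 6 * a + b ≤ 6 * c) : (2 : ℝ) ^ a ≤ 2 ^ c * θ ^ b := by
  have e : ∀ d : ℕ, (2 : ℝ) ^ d * θ ^ (6 * d) = 1 := by
    intro d
    rw [pow_mul, h6, ← mul_pow]
    norm_num
  have hp : 0 < θ ^ (6 * a) := by positivity
  refine le_of_mul_le_mul_right ?_ hp
  rw [e, mul_assoc, ← pow_add, ← e c]
  gcongr ?_ * ?_
  exact pow_le_pow_of_le_one h0.le h1 (by omega)

lemma relCount_singleton_le {θ : ℝ} (h0 : 0 < θ) (h1 : θ ≤ 1) (h6 : θ ^ 6 = 1 / 2)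
    (f : Fin n → Fin n) (hI : I.card = 1) :
    (relCount f I : ℝ) ≤ 2 ^ (n + 1).choose 3 *
      (θ ^ (3 * (n - 1))) ^ (Finset.univ.filter fun x => f x ≠ x).card := by
  rcases isEmpty_or_nonempty {T : Finset (Fin n × Fin n × Fin n) // IsFAS (f, I, T)} with he | he
  · rw [relCount, Nat.card_of_isEmpty, Nat.cast_zero]
    positivity
  obtain ⟨T, hT⟩ := he
  have hf := involutive_of_isFAS hT
  have hfI : ∀ i ∈ I, f i = i := fun i hi => fixed_of_isFAS hT hi
  have hle := relCount_le hf hfI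
  rw [hI] at hle
  norm_num at hle
  have horb := six_mul_card_twistedOrbits_le _ (restrict_involutive hf hfI)
  have hfix := card_fixed_add_card_moved_le hf hfI
  have hn := card_add_card_notMem I
  set o := Nat.card (TwistedOrbits _ (restrict_involutive hf hfI))
  set k := Nat.card {x // x ∉ I}
  set t := (Finset.univ.filter fun x => f x ≠ x).card
  set F := Nat.card {x // restrict f I hf hfI x = x}
  have hnk : n = k + 1 := by omega
  have hle' : (relCount f I : ℝ) ≤ 2 ^ o := by exact_mod_cast hle
  refine hle'.trans ?_
  rw [← pow_mul]
  apply two_pow_le_of_sixth_root h0 h1 h6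
  rw [show n + 1 = k + 2 by omega, six_mul_choose_three, show n - 1 = k by omega]
  nlinarith [Nat.mul_le_mul_left k hfix]

lemma relCount_le_of_two_le {θ : ℝ} (h0 : 0 < θ) (h1 : θ ≤ 1) (h6 : θ ^ 6 = 1 / 2)
    (h4 : 4 * θ ^ (n + 1) ≤ 1) (f : Fin n → Fin n) (hI : 2 ≤ I.card) :
    (relCount f I : ℝ) ≤ 2 ^ (n + 1).choose 3 * (4 * θ ^ (n + 1)) ^ n := by
  rcases isEmpty_or_nonempty {T : Finset (Fin n × Fin n × Fin n) // IsFAS (f, I, T)} with he | he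
  · rw [relCount, Nat.card_of_isEmpty, Nat.cast_zero]
    positivity
  obtain ⟨T, hT⟩ := he
  have hf := involutive_of_isFAS hT
  have hfI : ∀ i ∈ I, f i = i := fun i hi => fixed_of_isFAS hT hi
  have hle := relCount_le hf hfI
  have horb := six_mul_card_twistedOrbits_le _ (restrict_involutive hf hfI)
  have hfix := card_fixed_add_card_moved_le hf hfI
  have hn := card_add_card_notMem I
  set o := Nat.card (TwistedOrbits _ (restrict_involutive hf hfI))
  set k := Nat.card {x // x ∉ I}
  set F := Nat.card {x // restrict f I hf hfI x = x}
  obtain ⟨m, hm⟩ : ∃ m, I.card = m + 1 := ⟨I.card - 1, by omega⟩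
  have ho : 6 * o + (n + 1) * n * m ≤ 6 * (n + 1).choose 3 := by
    obtain ⟨l, hl⟩ : ∃ l, n = l + 1 := ⟨n - 1, by omega⟩
    have hlk : l = k + m := by omega
    rw [hl, six_mul_choose_three, hlk]
    have hFk : k * F ≤ k * k := Nat.mul_le_mul_left k (by omega)
    have : 6 * o ≤ k * (k + 1) * (k + 2) := by nlinarith
    refine (Nat.add_le_add_right this _).trans ?_
    have : k * (k + 1) * (k + 2) ≤ k * (k + m + 1) * (k + m + 2) := by gcongr <;> omega
    nlinarith
  have hsub : (2 : ℕ) ^ I.card - 1 ≤ 4 ^ m := by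
    have : (4 : ℕ) ^ m = 2 ^ (2 * m) := by rw [pow_mul]; norm_num
    rw [this]
    exact (Nat.sub_le _ _).trans (Nat.pow_le_pow_right (by norm_num) (by omega))
  have hle' : (relCount f I : ℝ) ≤ 2 ^ o * (4 ^ m) ^ n := by
    exact_mod_cast hle.trans (Nat.mul_le_mul_left _ (Nat.pow_le_pow_left hsub n))
  calc (relCount f I : ℝ) ≤ 2 ^ o * (4 ^ m) ^ n := hle'
    _ ≤ (2 ^ (n + 1).choose 3 * θ ^ ((n + 1) * n * m)) * (4 ^ m) ^ n := by
      gcongr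
      exact two_pow_le_of_sixth_root h0 h1 h6 ho
    _ = 2 ^ (n + 1).choose 3 * (4 * θ ^ (n + 1)) ^ (n * m) := by
      rw [mul_pow, ← pow_mul, ← pow_mul, mul_comm m n, mul_assoc (n + 1)]
      ring
    _ ≤ 2 ^ (n + 1).choose 3 * (4 * θ ^ (n + 1)) ^ n := by
      gcongr ?_ * ?_
      exact pow_le_pow_of_le_one (by positivity) h4 (Nat.le_mul_of_pos_right n (by omega))

lemma relCount_empty (hn : 0 < n) (f : Fin n → Fin n) : relCount f ∅ = 0 := by
  have : IsEmpty {T : Finset (Fin n × Fin n × Fin n) // IsFAS (f, ∅, T)} := by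
    refine ⟨fun T => ?_⟩
    obtain ⟨i, hi, -⟩ := (T.2.2 ⟨0, hn⟩ ⟨0, hn⟩).1 rfl
    simp at hi
  exact Nat.card_of_isEmpty

lemma sum_pow_card_moved_le {q : ℝ} (hq : 0 ≤ q) :
    ∑ f : Fin n → Fin n, q ^ (Finset.univ.filter fun x => f x ≠ x).card ≤ (1 + n * q) ^ n := by
  have h : ∀ f : Fin n → Fin n, q ^ (Finset.univ.filter fun x => f x ≠ x).card =
      ∏ x, if f x ≠ x then q else 1 := by
    intro f
    rw [Finset.prod_ite]
    simp
  simp only [h]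
  rw [← Fintype.piFinset_univ, ← Finset.prod_univ_sum (fun _ => Finset.univ)
    (fun x y : Fin n => if y ≠ x then q else 1)]
  refine (Finset.prod_le_prod (g := fun _ => 1 + n * q) ?_ ?_).trans (by simp)
  · intro x _
    exact Finset.sum_nonneg fun y _ => by split_ifs <;> positivity
  · intro x _
    calc ∑ y, (if y ≠ x then q else 1) ≤ ∑ y, ((if y = x then 1 else 0) + q) := by
          refine Finset.sum_le_sum fun y _ => ?_
          split_ifs <;> simp_all
      _ = 1 + n * q := by simp [Finset.sum_add_distrib]

lemma card_isFAS_le {θ : ℝ} (h0 : 0 < θ) (h1 : θ ≤ 1) (h6 : θ ^ 6 = 1 / 2)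
    (h4 : 4 * θ ^ (n + 1) ≤ 1) (hn : 0 < n) :
    (Nat.card {M : FASData n // IsFAS M} : ℝ) ≤ 2 ^ (n + 1).choose 3 *
      (n * (1 + n * θ ^ (3 * (n - 1))) ^ n + (8 * (n * θ ^ (n + 1))) ^ n) := by
  have hle : Nat.card {M : FASData n // IsFAS M} ≤
      ∑ I : Finset (Fin n), ∑ f : Fin n → Fin n, relCount f I := by
    rw [← Finset.sum_product', Finset.univ_product_univ]
    simp only [relCount]
    rw [← Nat.card_sigma]
    refine Nat.card_le_card_of_injective
      (fun M => ⟨(M.1.2.1, M.1.1), ⟨M.1.2.2, M.2⟩⟩) ?_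
    rintro ⟨⟨f, I, T⟩, h⟩ ⟨⟨f', I', T'⟩, h'⟩ he
    simp only [Sigma.mk.injEq, Prod.mk.injEq] at he
    obtain ⟨⟨rfl, rfl⟩, he⟩ := he
    simpa using he
  have hle' : (Nat.card {M : FASData n // IsFAS M} : ℝ) ≤
      ∑ I : Finset (Fin n), ∑ f : Fin n → Fin n, (relCount f I : ℝ) := by exact_mod_cast hle
  set N : ℝ := 2 ^ (n + 1).choose 3
  set q : ℝ := θ ^ (3 * (n - 1))
  have hq : 0 ≤ q := by positivity
  have hN : 0 ≤ N := by positivity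
  have hterm : ∀ (I : Finset (Fin n)) (f : Fin n → Fin n), (relCount f I : ℝ) ≤
      (if I.card = 1 then N * q ^ (Finset.univ.filter fun x => f x ≠ x).card else 0) +
        N * (4 * θ ^ (n + 1)) ^ n := by
    intro I f
    have hpos : 0 ≤ N * (4 * θ ^ (n + 1)) ^ n := by positivity
    split_ifs with hI
    · exact (relCount_singleton_le h0 h1 h6 f hI).trans (by linarith)
    · rw [zero_add]
      rcases Nat.eq_zero_or_pos I.card with hI0 | hI0
      · rw [Finset.card_eq_zero.1 hI0, relCount_empty hn]
        simpa using hpos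
      · exact relCount_le_of_two_le h0 h1 h6 h4 f (by omega)
  have hsing : ∑ I : Finset (Fin n), (if I.card = 1 then (1 : ℝ) else 0) = n := by
    rw [Finset.sum_boole, ← Finset.powerset_univ, ← Finset.powersetCard_eq_filter,
      Finset.card_powersetCard]
    simp
  refine hle'.trans ((Finset.sum_le_sum fun I _ => Finset.sum_le_sum fun f _ => hterm I f).trans ?_)
  simp only [Finset.sum_add_distrib, Finset.sum_const, Finset.card_univ, Fintype.card_finset,
    Fintype.card_fin, Fintype.card_fun, nsmul_eq_mul, mul_add]
  refine add_le_add ?_ (le_of_eq ?_)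
  · calc _ = ∑ I : Finset (Fin n), (if I.card = 1 then (1 : ℝ) else 0) * (N *
          ∑ f : Fin n → Fin n, q ^ (Finset.univ.filter fun x => f x ≠ x).card) := by
          refine Finset.sum_congr rfl fun I _ => ?_
          split_ifs <;> simp [Finset.mul_sum]
      _ = N * (n * ∑ f : Fin n → Fin n, q ^ (Finset.univ.filter fun x => f x ≠ x).card) := by
          rw [← Finset.sum_mul, hsing]
          ring
      _ ≤ _ := by
          gcongr
          exact sum_pow_card_moved_le hq
  · push_cast
    rw [show (8 : ℝ) * (n * θ ^ (n + 1)) = 2 * (n * (4 * θ ^ (n + 1))) by ring, mul_pow, mul_pow]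
    ring

end Structure

section LowerBound

/-- Sets avoiding each of a family of disjoint pairs are exponentially rare. -/
lemma card_avoiding_pairs_le {X ι : Type*} [Fintype X] [DecidableEq X] [DecidableEq ι]
    (p q : ι → X) (Y : Finset ι)
    (hY : ∀ x ∈ Y, ∀ y ∈ Y, x ≠ y → p x ≠ p y ∧ p x ≠ q y ∧ q x ≠ p y ∧ q x ≠ q y) :
    4 ^ Y.card * (Finset.univ.filter fun D : Finset X =>
      ∀ x ∈ Y, ¬(p x ∈ D ∧ q x ∈ D)).card ≤ 3 ^ Y.card * 2 ^ Fintype.card X := by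
  induction Y using Finset.induction_on with
  | empty => simp
  | insert y Y hy ih =>
    have ih := ih fun x hx z hz => hY x (Finset.mem_insert_of_mem hx) z (Finset.mem_insert_of_mem hz)
    set A := Finset.univ.filter fun D : Finset X => ∀ x ∈ Y, ¬(p x ∈ D ∧ q x ∈ D) with hA
    have hsplit : (A.filter fun D => p y ∈ D ∧ q y ∈ D).card +
        (A.filter fun D => ¬(p y ∈ D ∧ q y ∈ D)).card = A.card :=
      Finset.card_filter_add_card_filter_not _
    have hins : (Finset.univ.filter fun D : Finset X =>
        ∀ x ∈ insert y Y, ¬(p x ∈ D ∧ q x ∈ D)) = A.filter fun D => ¬(p y ∈ D ∧ q y ∈ D) := by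
      ext D
      simp only [hA, Finset.mem_filter, Finset.mem_univ, true_and, Finset.forall_mem_insert]
      tauto
    have hfib : A.card ≤ 4 * (A.filter fun D => p y ∈ D ∧ q y ∈ D).card := by
      refine Finset.card_le_mul_card_image_of_maps_to (f := fun D => D ∪ {p y, q y}) ?_ 4 ?_
      · intro D hD
        simp only [hA, Finset.mem_filter, Finset.mem_univ, true_and] at hD ⊢
        refine ⟨fun x hx => ?_, by simp⟩
        have hxy : x ≠ y := fun h => hy (h ▸ hx)
        have := hY x (Finset.mem_insert_of_mem hx) y (Finset.mem_insert_self _ _) hxy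
        have := hD x hx
        simp_all
      · intro E _
        have hpow : ({p y, q y} : Finset X).powerset.card ≤ 4 := by
          rw [Finset.card_powerset]
          calc 2 ^ ({p y, q y} : Finset X).card ≤ 2 ^ 2 :=
                Nat.pow_le_pow_right (by norm_num) Finset.card_le_two
            _ = 4 := by norm_num
        refine (Finset.card_le_card_of_injOn (fun D => D ∩ {p y, q y}) ?_ ?_).trans hpow
        · intro D _
          simp
        · intro D hD D' hD' h
          simp only [Finset.coe_filter, Set.mem_ofPred_eq] at hD hD'
          have hu := hD.2.trans hD'.2.symm
          ext z
          have h1 := Finset.ext_iff.1 h z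
          have h2 := Finset.ext_iff.1 hu z
          simp only [Finset.mem_inter, Finset.mem_union] at h1 h2
          tauto
    rw [hins, Finset.card_insert_of_notMem hy, pow_succ, pow_succ]
    have : 4 * (A.filter fun D => ¬(p y ∈ D ∧ q y ∈ D)).card ≤ 3 * A.card := by omega
    calc 4 ^ Y.card * 4 * (A.filter fun D => ¬(p y ∈ D ∧ q y ∈ D)).card
        ≤ 4 ^ Y.card * (3 * A.card) := by rw [mul_assoc]; gcongr
      _ = 3 * (4 ^ Y.card * A.card) := by ring
      _ ≤ 3 * (3 ^ Y.card * 2 ^ Fintype.card X) := by gcongr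
      _ = _ := by ring

variable {V : Type*}

/-- The multiset `{a, b, c}` as an element of the symmetric power. -/
def symTriple (a b c : V) : Sym V 3 := ⟨{a, b, c}, rfl⟩

lemma mem_symTriple {a b c x : V} : x ∈ symTriple a b c ↔ x = a ∨ x = b ∨ x = c := by
  change x ∈ ({a, b, c} : Multiset V) ↔ _
  simp

lemma symTriple_swap_left (a b c : V) : symTriple b a c = symTriple a b c :=
  Subtype.ext (Multiset.cons_swap b a {c})

lemma symTriple_swap_right (a b c : V) : symTriple a c b = symTriple a b c :=
  Subtype.ext (congrArg (a ::ₘ ·) (Multiset.cons_swap c b 0))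

lemma exists_eq_symTriple (s : Sym V 3) : ∃ a b c, s = symTriple a b c := by
  obtain ⟨a, b, c, h⟩ := Multiset.card_eq_three.1 s.2
  exact ⟨a, b, c, Subtype.ext h⟩

/-- A set of unordered triples is saturated if any two pairs can be completed by a common
element. -/
def Saturated (D : Finset (Sym V 3)) : Prop :=
  ∀ a b c d, ∃ x, symTriple a b x ∈ D ∧ symTriple x c d ∈ D

lemma card_not_saturated_le [Fintype V] :
    (Nat.card {D : Finset (Sym V 3) // ¬Saturated D} : ℝ) ≤
      Fintype.card V ^ 4 * (3 / 4) ^ (Fintype.card V - 4) * 2 ^ (Fintype.card V + 2).choose 3 := by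
  classical
  let Y (v : V × V × V × V) : Finset V := {v.1, v.2.1, v.2.2.1, v.2.2.2}ᶜ
  let B (v : V × V × V × V) : Finset (Finset (Sym V 3)) := Finset.univ.filter fun D =>
    ∀ x ∈ Y v, ¬(symTriple v.1 v.2.1 x ∈ D ∧ symTriple x v.2.2.1 v.2.2.2 ∈ D)
  have hB : ∀ v, ((B v).card : ℝ) ≤
      (3 / 4) ^ (Fintype.card V - 4) * 2 ^ (Fintype.card V + 2).choose 3 := by
    rintro ⟨a, b, c, d⟩
    have h := card_avoiding_pairs_le (fun x => symTriple a b x) (fun x => symTriple x c d)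
      (Y (a, b, c, d)) (by
        intro x hx y hy hxy
        simp only [Y, Finset.mem_compl, Finset.mem_insert, Finset.mem_singleton, not_or] at hx hy
        have key : x ∉ symTriple a b y ∧ x ∉ symTriple y c d := by
          simp only [mem_symTriple]
          tauto
        have m1 : x ∈ symTriple a b x := by simp [mem_symTriple]
        have m2 : x ∈ symTriple x c d := by simp [mem_symTriple]
        exact ⟨fun h => key.1 (h ▸ m1), fun h => key.2 (h ▸ m1),
          fun h => key.1 (h ▸ m2), fun h => key.2 (h ▸ m2)⟩)
    rw [Sym.card_sym_eq_choose, Nat.add_sub_assoc (by norm_num)] at h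
    have hr : (4 : ℝ) ^ (Y (a, b, c, d)).card * (B (a, b, c, d)).card ≤
        3 ^ (Y (a, b, c, d)).card * 2 ^ (Fintype.card V + 2).choose 3 := by
      norm_cast
      convert h
    have hYc : Fintype.card V - 4 ≤ (Y (a, b, c, d)).card := by
      have : ({a, b, c, d} : Finset V).card ≤ 4 := Finset.card_le_four
      simp only [Y, Finset.card_compl]
      omega
    calc ((B (a, b, c, d)).card : ℝ)
        ≤ (3 / 4) ^ (Y (a, b, c, d)).card * 2 ^ (Fintype.card V + 2).choose 3 := by
          rw [div_pow, div_mul_eq_mul_div, le_div_iff₀ (by positivity)]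
          linarith
      _ ≤ _ := by
          gcongr ?_ * ?_
          exact pow_le_pow_of_le_one (by norm_num) (by norm_num) hYc
  have hsub : (Finset.univ.filter fun D : Finset (Sym V 3) => ¬Saturated D) ⊆
      Finset.univ.biUnion B := by
    intro D hD
    have hD := (Finset.mem_filter.1 hD).2
    simp only [Saturated, not_forall, not_exists, not_and] at hD
    obtain ⟨a, b, c, d, h⟩ := hD
    refine Finset.mem_biUnion.2 ⟨(a, b, c, d), Finset.mem_univ _, ?_⟩
    simp only [B, Finset.mem_filter, Finset.mem_univ, true_and]
    exact fun x _ hx => h x hx.1 hx.2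
  rw [Nat.card_eq_fintype_card, Fintype.card_subtype]
  calc ((Finset.univ.filter fun D : Finset (Sym V 3) => ¬Saturated D).card : ℝ)
      ≤ ∑ v, ((B v).card : ℝ) := by
        exact_mod_cast (Finset.card_le_card hsub).trans Finset.card_biUnion_le
    _ ≤ ∑ v : V × V × V × V,
          (3 / 4 : ℝ) ^ (Fintype.card V - 4) * 2 ^ (Fintype.card V + 2).choose 3 :=
        Finset.sum_le_sum fun v _ => hB v
    _ = _ := by
        simp only [Finset.sum_const, Finset.card_univ, Fintype.card_prod, nsmul_eq_mul]
        push_cast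
        ring

variable {n : ℕ}

open Classical in
/-- The symmetric ternary relation with identity atom `e` whose non-identity triples are
given by `D`. -/
noncomputable def buildRel (e : Fin n) (D : Finset (Sym {x : Fin n // x ≠ e} 3)) :
    Finset (Fin n × Fin n × Fin n) :=
  Finset.univ.filter fun t =>
    (∃ (ha : t.1 ≠ e) (hb : t.2.1 ≠ e) (hc : t.2.2 ≠ e),
      symTriple ⟨t.1, ha⟩ ⟨t.2.1, hb⟩ ⟨t.2.2, hc⟩ ∈ D) ∨
    (t.1 = e ∧ t.2.1 = t.2.2) ∨ (t.2.1 = e ∧ t.1 = t.2.2) ∨ (t.2.2 = e ∧ t.1 = t.2.1)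

variable {e : Fin n} {D : Finset (Sym {x : Fin n // x ≠ e} 3)}

lemma mem_buildRel {a b c : Fin n} : (a, b, c) ∈ buildRel e D ↔
    (∃ (ha : a ≠ e) (hb : b ≠ e) (hc : c ≠ e), symTriple ⟨a, ha⟩ ⟨b, hb⟩ ⟨c, hc⟩ ∈ D) ∨
    (a = e ∧ b = c) ∨ (b = e ∧ a = c) ∨ (c = e ∧ a = b) := by
  simp [buildRel]

lemma mem_buildRel_of_ne {a b c : Fin n} (ha : a ≠ e) (hb : b ≠ e) (hc : c ≠ e) :
    (a, b, c) ∈ buildRel e D ↔ symTriple ⟨a, ha⟩ ⟨b, hb⟩ ⟨c, hc⟩ ∈ D := by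
  simp [mem_buildRel, ha, hb, hc]

lemma mem_buildRel_left {b c : Fin n} : (e, b, c) ∈ buildRel e D ↔ b = c := by
  simp only [mem_buildRel]
  grind

lemma mem_buildRel_mid {a c : Fin n} : (a, e, c) ∈ buildRel e D ↔ a = c := by
  simp only [mem_buildRel]
  grind

lemma mem_buildRel_right {a b : Fin n} : (a, b, e) ∈ buildRel e D ↔ a = b := by
  simp only [mem_buildRel]
  grind

lemma buildRel_swap_right {a b c : Fin n} :
    (a, c, b) ∈ buildRel e D ↔ (a, b, c) ∈ buildRel e D := by
  by_cases ha : a = e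
  · subst ha
    simp only [mem_buildRel_left, eq_comm]
  by_cases hb : b = e
  · subst hb
    simp only [mem_buildRel_mid, mem_buildRel_right]
  by_cases hc : c = e
  · subst hc
    simp only [mem_buildRel_mid, mem_buildRel_right]
  rw [mem_buildRel_of_ne ha hc hb, mem_buildRel_of_ne ha hb hc, symTriple_swap_right]

lemma buildRel_swap_left {a b c : Fin n} :
    (b, a, c) ∈ buildRel e D ↔ (a, b, c) ∈ buildRel e D := by
  by_cases ha : a = e
  · subst ha
    simp only [mem_buildRel_left, mem_buildRel_mid]
  by_cases hb : b = e
  · subst hb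
    simp only [mem_buildRel_left, mem_buildRel_mid]
  by_cases hc : c = e
  · subst hc
    simp only [mem_buildRel_right, eq_comm]
  rw [mem_buildRel_of_ne hb ha hc, mem_buildRel_of_ne ha hb hc, symTriple_swap_left]

lemma isFAS_buildRel : IsFAS (id, {e}, buildRel e D) := by
  refine ⟨fun a b c h => ⟨buildRel_swap_right.2 h, ?_⟩, fun a b => ?_⟩
  · exact buildRel_swap_right.1 (buildRel_swap_left.1 (buildRel_swap_right.2 h))
  · simp [mem_buildRel_mid]

lemma associative_buildRel (hD : Saturated D) : FASAssociative (id, {e}, buildRel e D) := by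
  intro a b c d
  change (∃ x, (a, b, x) ∈ buildRel e D ∧ (x, c, d) ∈ buildRel e D) ↔
    ∃ y, (b, c, y) ∈ buildRel e D ∧ (a, y, d) ∈ buildRel e D
  by_cases ha : a = e
  · subst ha
    simp [mem_buildRel_left]
  by_cases hb : b = e
  · subst hb
    simp [mem_buildRel_left, mem_buildRel_mid]
  by_cases hc : c = e
  · subst hc
    simp [mem_buildRel_mid]
  by_cases hd : d = e
  · subst hd
    simp [mem_buildRel_right, buildRel_swap_right, buildRel_swap_left]
  obtain ⟨x, hx1, hx2⟩ := hD ⟨a, ha⟩ ⟨b, hb⟩ ⟨c, hc⟩ ⟨d, hd⟩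
  obtain ⟨y, hy1, hy2⟩ := hD ⟨b, hb⟩ ⟨c, hc⟩ ⟨a, ha⟩ ⟨d, hd⟩
  refine iff_of_true ⟨x, (mem_buildRel_of_ne ha hb x.2).2 hx1, (mem_buildRel_of_ne x.2 hc hd).2 hx2⟩
    ⟨y, (mem_buildRel_of_ne hb hc y.2).2 hy1, buildRel_swap_left.1 ?_⟩
  exact (mem_buildRel_of_ne y.2 ha hd).2 hy2

lemma buildRel_injective (e : Fin n) :
    Function.Injective (buildRel e : Finset (Sym {x : Fin n // x ≠ e} 3) → _) := by
  intro D D' h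
  ext s
  obtain ⟨⟨a, ha⟩, ⟨b, hb⟩, ⟨c, hc⟩, rfl⟩ := exists_eq_symTriple s
  rw [← mem_buildRel_of_ne ha hb hc, ← mem_buildRel_of_ne ha hb hc, h]

lemma le_card_saturated (e : Fin n) :
    (2 : ℝ) ^ (n + 1).choose 3 * (1 - n ^ 4 * (3 / 4) ^ (n - 5)) ≤
      Nat.card {D : Finset (Sym {x : Fin n // x ≠ e} 3) // Saturated D} := by
  classical
  have hV : Fintype.card {x : Fin n // x ≠ e} = n - 1 := by simp
  have hn : 0 < n := e.pos
  have hbad := card_not_saturated_le (V := {x : Fin n // x ≠ e})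
  have hsplit := Nat.card_congr
    (Equiv.sumCompl fun D : Finset (Sym {x : Fin n // x ≠ e} 3) => Saturated D)
  rw [Nat.card_sum, Nat.card_eq_fintype_card (α := Finset _), Fintype.card_finset,
    Sym.card_sym_eq_choose, hV, show n - 1 + 3 - 1 = n + 1 by omega] at hsplit
  rw [hV, show n - 1 + 2 = n + 1 by omega, show n - 1 - 4 = n - 5 by omega] at hbad
  have hsplit' : (Nat.card {D : Finset (Sym {x : Fin n // x ≠ e} 3) // Saturated D} : ℝ) +
      Nat.card {D : Finset (Sym {x : Fin n // x ≠ e} 3) // ¬Saturated D} =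
      2 ^ (n + 1).choose 3 := by exact_mod_cast hsplit
  have hmono : ((n - 1 : ℕ) : ℝ) ^ 4 * (3 / 4) ^ (n - 5) * 2 ^ (n + 1).choose 3 ≤
      n ^ 4 * (3 / 4) ^ (n - 5) * 2 ^ (n + 1).choose 3 := by
    gcongr
    omega
  linarith

lemma le_card_good (n : ℕ) :
    n * ((2 : ℝ) ^ (n + 1).choose 3 * (1 - n ^ 4 * (3 / 4) ^ (n - 5))) ≤
      Nat.card {M : FASData n //
        IsFAS M ∧ FASSymmetric M ∧ FASIntegral M ∧ FASAssociative M} := by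
  have h : ∑ e : Fin n, Nat.card {D : Finset (Sym {x : Fin n // x ≠ e} 3) // Saturated D} ≤
      Nat.card {M : FASData n //
        IsFAS M ∧ FASSymmetric M ∧ FASIntegral M ∧ FASAssociative M} := by
    rw [← Nat.card_sigma]
    refine Nat.card_le_card_of_injective (fun p => ⟨(id, {p.1}, buildRel p.1 p.2.1),
      isFAS_buildRel, fun _ => rfl, Finset.card_singleton _, associative_buildRel p.2.2⟩) ?_
    rintro ⟨e, D, hD⟩ ⟨e', D', hD'⟩ h
    simp only [Subtype.mk.injEq, Prod.mk.injEq, Finset.singleton_inj, true_and] at h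
    obtain ⟨rfl, h⟩ := h
    cases buildRel_injective e h
    rfl
  have h' : ∑ e : Fin n,
      (Nat.card {D : Finset (Sym {x : Fin n // x ≠ e} 3) // Saturated D} : ℝ) ≤
      Nat.card {M : FASData n //
        IsFAS M ∧ FASSymmetric M ∧ FASIntegral M ∧ FASAssociative M} := by exact_mod_cast h
  refine le_trans ?_ ((Finset.sum_le_sum fun e _ => le_card_saturated e).trans h')
  simp

end LowerBound

section Limits

lemma exists_sixth_root : ∃ θ : ℝ, 0 < θ ∧ θ < 1 ∧ θ ^ 6 = 1 / 2 := by
  refine ⟨(1 / 2 : ℝ) ^ (1 / 6 : ℝ), by positivity,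
    Real.rpow_lt_one (by norm_num) (by norm_num) (by norm_num), ?_⟩
  rw [← Real.rpow_natCast, ← Real.rpow_mul (by norm_num)]
  norm_num

lemma tendsto_failure_bound :
    Tendsto (fun n : ℕ => (n : ℝ) ^ 4 * (3 / 4) ^ (n - 5)) atTop (𝓝 0) := by
  have h := (tendsto_pow_const_mul_const_pow_of_abs_lt_one 4
    (r := (3 / 4 : ℝ)) (by norm_num [abs_of_pos])).const_mul ((4 / 3 : ℝ) ^ 5)
  rw [mul_zero] at h
  refine h.congr' ?_
  filter_upwards [eventually_ge_atTop 5] with n hn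
  obtain ⟨m, rfl⟩ := Nat.exists_eq_add_of_le hn
  rw [Nat.add_sub_cancel_left, pow_add]
  ring

variable {θ : ℝ}

lemma tendsto_asymmetric_bound (h0 : 0 < θ) (h1 : θ < 1) :
    Tendsto (fun n : ℕ => (1 + n * θ ^ (3 * (n - 1))) ^ n) atTop (𝓝 1) := by
  have h3 : |θ ^ 3| < 1 := by
    rw [abs_of_pos (by positivity)]
    exact pow_lt_one₀ h0.le h1 (by norm_num)
  have h := (tendsto_pow_const_mul_const_pow_of_abs_lt_one 2 h3).const_mul (θ ^ 3)⁻¹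
  rw [mul_zero] at h
  have hexp := (Real.continuous_exp.tendsto 0).comp h
  rw [Real.exp_zero] at hexp
  refine tendsto_of_tendsto_of_tendsto_of_le_of_le' tendsto_const_nhds hexp ?_ ?_
  · exact Eventually.of_forall fun n => one_le_pow₀ (by simp; positivity)
  · filter_upwards [eventually_ge_atTop 1] with n hn
    obtain ⟨m, rfl⟩ := Nat.exists_eq_add_of_le hn
    calc (1 + ((1 + m : ℕ) : ℝ) * θ ^ (3 * (1 + m - 1))) ^ (1 + m)
        ≤ Real.exp (((1 + m : ℕ) : ℝ) * θ ^ (3 * (1 + m - 1))) ^ (1 + m) := by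
          gcongr
          rw [add_comm]
          exact Real.add_one_le_exp _
      _ = _ := by
          rw [← Real.exp_nat_mul, Nat.add_sub_cancel_left, Function.comp_apply]
          congr 1
          rw [pow_mul, pow_add (θ ^ 3)]
          field_simp

lemma tendsto_nonintegral_base (h0 : 0 < θ) (h1 : θ < 1) :
    Tendsto (fun n : ℕ => 8 * (n * θ ^ (n + 1))) atTop (𝓝 0) := by
  have h := (tendsto_self_mul_const_pow_of_lt_one h0.le h1).const_mul (8 * θ)
  rw [mul_zero] at h
  refine h.congr fun n => ?_
  ring

lemma tendsto_nonintegral_bound (h0 : 0 < θ) (h1 : θ < 1) :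
    Tendsto (fun n : ℕ => (8 * (n * θ ^ (n + 1))) ^ n) atTop (𝓝 0) := by
  refine tendsto_of_tendsto_of_tendsto_of_le_of_le' tendsto_const_nhds
    (tendsto_pow_atTop_nhds_zero_of_lt_one (r := (1 / 2 : ℝ)) (by norm_num) (by norm_num)) ?_ ?_
  · exact Eventually.of_forall fun n => by positivity
  · filter_upwards [(tendsto_nonintegral_base h0 h1).eventually_le_const
      (show (0 : ℝ) < 1 / 2 by norm_num)] with n hn
    gcongr

end Limits

end FASCount

/-- Almost all finite nonassociative relation algebras are symmetric integral
relation algebras: the fraction of labelled FAS structures that are symmetric,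
integral, and associative tends to 1. -/
theorem stmt2 :
    Tendsto (fun n : ℕ =>
      (Nat.card {M : FASData n //
        IsFAS M ∧ FASSymmetric M ∧ FASIntegral M ∧ FASAssociative M} : ℝ) /
      (Nat.card {M : FASData n // IsFAS M} : ℝ))
      atTop (𝓝 1) := by
  obtain ⟨θ, h0, h1, h6⟩ := FASCount.exists_sixth_root
  have hlow : Tendsto (fun n : ℕ => (1 - (n : ℝ) ^ 4 * (3 / 4) ^ (n - 5)) /
      ((1 + n * θ ^ (3 * (n - 1))) ^ n + (8 * (n * θ ^ (n + 1))) ^ n)) atTop (𝓝 1) := by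
    have := (FASCount.tendsto_failure_bound.const_sub 1).div
      ((FASCount.tendsto_asymmetric_bound h0 h1).add
        (FASCount.tendsto_nonintegral_bound h0 h1)) (by norm_num)
    simpa [Pi.div_def] using this
  have hle : ∀ n, (Nat.card {M : FASData n //
      IsFAS M ∧ FASSymmetric M ∧ FASIntegral M ∧ FASAssociative M} : ℝ) ≤
      Nat.card {M : FASData n // IsFAS M} := fun n => by
    exact_mod_cast Nat.card_le_card_of_injective (Subtype.map id fun M
      (h : IsFAS M ∧ FASSymmetric M ∧ FASIntegral M ∧ FASAssociative M) => h.1)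
      (Subtype.map_injective _ Function.injective_id)
  refine tendsto_of_tendsto_of_tendsto_of_le_of_le' hlow tendsto_const_nhds ?_ ?_
  · filter_upwards [eventually_ge_atTop 1,
      (FASCount.tendsto_nonintegral_base h0 h1).eventually_le_const
        (show (0 : ℝ) < 1 / 2 by norm_num),
      FASCount.tendsto_failure_bound.eventually_le_const (show (0 : ℝ) < 1 / 2 by norm_num)]
      with n hn hbase hfail
    have hn' : (1 : ℝ) ≤ n := by exact_mod_cast hn
    have h4 : 4 * θ ^ (n + 1) ≤ 1 := by
      have : 0 < θ ^ (n + 1) := by positivity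
      nlinarith
    have hup := FASCount.card_isFAS_le h0 h1.le h6 h4 hn
    have hgood := FASCount.le_card_good n
    set N : ℝ := 2 ^ (n + 1).choose 3
    set ε : ℝ := (n : ℝ) ^ 4 * (3 / 4) ^ (n - 5)
    set u : ℝ := (1 + n * θ ^ (3 * (n - 1))) ^ n
    set w : ℝ := (8 * (n * θ ^ (n + 1))) ^ n
    have hN : 0 < N := by positivity
    have hu : 0 < u := by positivity
    have hw : 0 < w := by positivity
    have hpos : 0 < n * (N * (1 - ε)) := by
      have : 0 < 1 - ε := by linarith
      positivity
    calc (1 - ε) / (u + w) = n * (N * (1 - ε)) / (N * (n * u + n * w)) := by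
          field_simp
      _ ≤ n * (N * (1 - ε)) / (N * (n * u + w)) := by
          gcongr
          nlinarith
      _ ≤ _ := by
          gcongr
          linarith [hle n]
  · exact Eventually.of_forall fun n => div_le_one_of_le₀ (hle n) (Nat.cast_nonneg _)
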